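/- arXiv:2404.15646 — 3 statements merged into one kernel-verified Lean document; each statement's English description precedes it below -/
import Mathlib

section
/- The complex linear span of {φ_s : s ∈ F_p^L} is exactly the simultaneous fixed subspace of the stabilizer generators; that is, a vector ψ : F_p^n → ℂ lies in span{φ_s : s ∈ F_p^L} if and only if (i) for every x ∈ C₁^⊥ and every v ∈ F_p^n, ω^{⟨x,v⟩} · ψ(v) = ψ(v), and (ii) for every y ∈ C₂ and every v ∈ F_p^n, ψ(v − y) = ψ(v). (This is the stabilizer-code description of Ogawa et al.'s (k, L, n) ramp quantum secret sharing scheme.) -/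
open scoped BigOperators

noncomputable section

/-- Evaluation map: `c ↦ (f_c(α₁), …, f_c(αₙ))` where `f_c(x) = c₁ + c₂ x + ⋯ + c_k x^{k-1}`. -/
def ev (p k n : ℕ) (α : Fin n → ZMod p) (c : Fin k → ZMod p) : Fin n → ZMod p :=
  fun i => ∑ j : Fin k, c j * α i ^ (j : ℕ)

/-- The evaluation map as a linear map over `F_p`. -/
def evLin (p k n : ℕ) (α : Fin n → ZMod p) :
    (Fin k → ZMod p) →ₗ[ZMod p] (Fin n → ZMod p) where
  toFun := ev p k n α
  map_add' c d := by
    funext i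
    simp [ev, add_mul, Finset.sum_add_distrib]
  map_smul' r c := by
    funext i
    simp [ev, Finset.mul_sum, mul_assoc]

/-- `D(0)`: the vectors in `F_p^k` whose first `L` coordinates are zero. -/
def Dzero (p k L : ℕ) (hLk : L ≤ k) : Submodule (ZMod p) (Fin k → ZMod p) where
  carrier := {c | ∀ i : Fin L, c (Fin.castLE hLk i) = 0}
  add_mem' := fun ha hb i => by simp [Pi.add_apply, ha i, hb i]
  zero_mem' := fun i => rfl
  smul_mem' := fun r c hc i => by simp [Pi.smul_apply, hc i]

/-- The dual code with respect to the standard bilinear form `⟨x,y⟩ = ∑ i, x i * y i`. -/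
def dualCode (p n : ℕ) (C : Submodule (ZMod p) (Fin n → ZMod p)) :
    Submodule (ZMod p) (Fin n → ZMod p) where
  carrier := {x | ∀ y ∈ C, ∑ i, x i * y i = 0}
  add_mem' := by
    intro a b ha hb y hy
    simp only [Pi.add_apply, add_mul, Finset.sum_add_distrib, ha y hy, hb y hy, add_zero]
  zero_mem' := by intro y _; simp
  smul_mem' := by
    intro r x hx y hy
    simp only [Pi.smul_apply, smul_eq_mul, mul_assoc, ← Finset.mul_sum, hx y hy, mul_zero]

/-- The state `φ_s = p^{-(k-L)/2} ∑_{c ∈ D(s)} e_{ev(c)}`, viewed as a function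
`F_p^n → ℂ`; here `D(s)` is the set of `c ∈ F_p^k` whose first `L` coordinates equal `s`,
and `e_{ev(c)}(v) = 1` if `ev(c) = v` and `0` otherwise. -/
def phi (p k L n : ℕ) [NeZero p] (hLk : L ≤ k) (α : Fin n → ZMod p)
    (s : Fin L → ZMod p) (v : Fin n → ZMod p) : ℂ :=
  ((Real.sqrt ((p : ℝ) ^ (k - L)) : ℂ))⁻¹ *
    ∑ c : Fin k → ZMod p,
      if (∀ i : Fin L, c (Fin.castLE hLk i) = s i) ∧ ev p k n α c = v then 1 else 0

lemma ev_injective {p k n : ℕ} [Fact p.Prime] (hkn : k ≤ n) {α : Fin n → ZMod p}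
    (hα : Function.Injective α) : Function.Injective (ev p k n α) := by
  refine (injective_iff_map_eq_zero (evLin p k n α)).2 fun c hc => ?_
  refine Matrix.eq_zero_of_forall_index_sum_mul_pow_eq_zero
    (f := fun i => α (Fin.castLE hkn i)) (hα.comp (Fin.castLE_injective hkn)) fun i => ?_
  exact congrFun hc (Fin.castLE hkn i)

lemma phi_ev {p k L n : ℕ} [NeZero p] (hLk : L ≤ k) {α : Fin n → ZMod p}
    (hev : Function.Injective (ev p k n α)) (s : Fin L → ZMod p) (c : Fin k → ZMod p) :
    phi p k L n hLk α s (ev p k n α c) =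
      ((Real.sqrt ((p : ℝ) ^ (k - L)) : ℂ))⁻¹ *
        if s = fun i => c (Fin.castLE hLk i) then 1 else 0 := by
  unfold phi
  congr 1
  rw [Finset.sum_eq_single c]
  · simp [funext_iff, eq_comm]
  · intro d _ hd
    rw [if_neg fun h => hd (hev h.2)]
  · simp

lemma phi_eq_zero_of_notMem_range {p k L n : ℕ} [NeZero p] (hLk : L ≤ k) {α : Fin n → ZMod p}
    (s : Fin L → ZMod p) {v : Fin n → ZMod p} (hv : v ∉ LinearMap.range (evLin p k n α)) :
    phi p k L n hLk α s v = 0 := by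
  unfold phi
  rw [Finset.sum_eq_zero, mul_zero]
  intro c _
  exact if_neg fun h => hv ⟨c, h.2⟩

lemma phi_sub_ev {p k L n : ℕ} [NeZero p] (hLk : L ≤ k) {α : Fin n → ZMod p}
    (s : Fin L → ZMod p) {d : Fin k → ZMod p} (hd : d ∈ Dzero p k L hLk) (v : Fin n → ZMod p) :
    phi p k L n hLk α s (v - evLin p k n α d) = phi p k L n hLk α s v := by
  unfold phi
  congr 1
  refine Fintype.sum_equiv (Equiv.addRight d) _ _ fun c => ?_
  have h_ev : ev p k n α (c + d) = ev p k n α c + evLin p k n α d :=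
    map_add (evLin p k n α) c d
  have h_res : ∀ i : Fin L, d (Fin.castLE hLk i) = 0 := hd
  simp [h_ev, h_res, eq_sub_iff_add_eq]

lemma exists_mem_dualCode_sum_ne_zero {p n : ℕ} [Fact p.Prime]
    {C : Submodule (ZMod p) (Fin n → ZMod p)} {v : Fin n → ZMod p} (hv : v ∉ C) :
    ∃ x ∈ dualCode p n C, ∑ i, x i * v i ≠ 0 := by
  obtain ⟨f, hfv, hfC⟩ := Submodule.exists_le_ker_of_notMem hv
  have hf : ∀ y, ∑ i, f (Pi.single i 1) * y i = f y := fun y => by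
    conv_rhs => rw [pi_eq_sum_univ' y, map_sum]
    simp [mul_comm]
  exact ⟨fun i => f (Pi.single i 1), fun y hy => (hf y).trans (hfC hy), by rwa [hf]⟩

/-- the complex linear span of `{φ_s : s ∈ F_p^L}` is exactly the
simultaneous fixed subspace of the stabilizer generators indexed by `C₁^⊥` (Z-type)
and `C₂` (X-type). -/
theorem span_phi_eq_stabilizer_code (p k L n : ℕ) [Fact p.Prime]
    (hk : 0 < k) (hL : 0 < L) (hn0 : 0 < n) (hLk : L ≤ k)
    (hn : n = 2 * k - L) (hnp : n < p)
    (α : Fin n → ZMod p) (hαinj : Function.Injective α) (hα0 : ∀ i, α i ≠ 0)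
    (ω : ℂ) (hω : ω = Complex.exp (2 * Real.pi * Complex.I / p)) :
    ∀ ψ : (Fin n → ZMod p) → ℂ,
      ψ ∈ Submodule.span ℂ (Set.range (phi p k L n hLk α)) ↔
        ((∀ x ∈ dualCode p n (LinearMap.range (evLin p k n α)),
            ∀ v : Fin n → ZMod p, ω ^ (∑ i, x i * v i).val * ψ v = ψ v) ∧
         (∀ y ∈ Submodule.map (evLin p k n α) (Dzero p k L hLk),
            ∀ v : Fin n → ZMod p, ψ (v - y) = ψ v)) := by
  subst hω
  have hp : p.Prime := Fact.out
  have hω := Complex.isPrimitiveRoot_exp p hp.ne_zero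
  have hev : Function.Injective (ev p k n α) := ev_injective (by omega) hαinj
  intro ψ
  constructor
  · intro hψ
    induction hψ using Submodule.span_induction with
    | mem ψ hψ =>
      obtain ⟨s, rfl⟩ := hψ
      refine ⟨fun x hx v => ?_, ?_⟩
      · by_cases hv : v ∈ LinearMap.range (evLin p k n α)
        · simp [hx v hv]
        · simp [phi_eq_zero_of_notMem_range hLk s hv]
      · rintro _ ⟨d, hd, rfl⟩ v
        exact phi_sub_ev hLk s hd v
    | zero => simp
    | add ψ χ _ _ hψ hχ =>
      refine ⟨fun x hx v => ?_, fun y hy v => ?_⟩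
      · rw [Pi.add_apply, mul_add, hψ.1 x hx, hχ.1 x hx]
      · rw [Pi.add_apply, Pi.add_apply, hψ.2 y hy, hχ.2 y hy]
    | smul a ψ _ hψ =>
      refine ⟨fun x hx v => ?_, fun y hy v => ?_⟩
      · rw [Pi.smul_apply, mul_smul_comm, hψ.1 x hx]
      · rw [Pi.smul_apply, Pi.smul_apply, hψ.2 y hy]
  · rintro ⟨hZ, hX⟩
    have h_supp : ∀ v ∉ LinearMap.range (evLin p k n α), ψ v = 0 := fun v hv => by
      obtain ⟨x, hx, hxv⟩ := exists_mem_dualCode_sum_ne_zero hv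
      by_contra h_ne
      refine hω.pow_ne_one_of_pos_of_lt (l := (∑ i, x i * v i).val) ?_ (ZMod.val_lt _)
        (mul_right_cancel₀ h_ne ?_)
      · rwa [Ne, ZMod.val_eq_zero]
      · rw [hZ x hx v, one_mul]
    have h_norm : (Real.sqrt ((p : ℝ) ^ (k - L)) : ℂ) ≠ 0 := by
      have : (0 : ℝ) < p := mod_cast hp.pos
      exact Complex.ofReal_ne_zero.2 (by positivity)
    let lift (s : Fin L → ZMod p) (j : Fin k) : ZMod p :=
      if h : (j : ℕ) < L then s ⟨j, h⟩ else 0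
    have h_sum : ψ = ∑ s, ((Real.sqrt ((p : ℝ) ^ (k - L)) : ℂ) * ψ (ev p k n α (lift s))) •
        phi p k L n hLk α s := by
      funext v
      rw [Finset.sum_apply]
      by_cases hv : v ∈ LinearMap.range (evLin p k n α)
      · obtain ⟨c, rfl⟩ := hv
        change ψ (ev p k n α c) = ∑ s, _ * phi p k L n hLk α s (ev p k n α c)
        simp only [phi_ev hLk hev, mul_ite, mul_one, mul_zero, Finset.sum_ite_eq',
          Finset.mem_univ, if_true]
        set r := lift fun i => c (Fin.castLE hLk i) with hr
        have h_mem : c - r ∈ Dzero p k L hLk := fun i => by simp [hr, lift]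
        have h_inv := hX _ (Submodule.mem_map_of_mem h_mem) (ev p k n α c)
        have h_ev : ev p k n α c - evLin p k n α (c - r) = ev p k n α r := by
          rw [map_sub]
          exact sub_sub_cancel _ _
        rw [h_ev] at h_inv
        rw [h_inv]
        field_simp
      · simp [h_supp v hv, phi_eq_zero_of_notMem_range hLk _ hv]
    rw [h_sum]
    exact Submodule.sum_mem _ fun s _ =>
      Submodule.smul_mem _ _ (Submodule.subset_span (Set.mem_range_self s))
end
end

section
/- If J is a set of coordinate positions with |J| ≤ k − L, then the shortened codes satisfy dim (C₁^⊥)_J = (k − L) − |J| and dim (C₂)_J = (k − L) − |J|; that is, shortening either code at any at most k − L positions decreases its dimension by exactly the number of shortened positions. -/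
open scoped BigOperators

noncomputable section

/-- The vectors vanishing on every coordinate in `J`. -/
def zeroAt (p n : ℕ) (J : Finset (Fin n)) : Submodule (ZMod p) (Fin n → ZMod p) where
  carrier := {w | ∀ i ∈ J, w i = 0}
  add_mem' := fun ha hb i hi => by simp [Pi.add_apply, ha i hi, hb i hi]
  zero_mem' := fun i _ => rfl
  smul_mem' := fun r w hw i hi => by simp [Pi.smul_apply, hw i hi]

/-- The shortened code `C_J = {w ∈ C : wᵢ = 0 for all i ∈ J}`. -/
def shortened (p n : ℕ) (C : Submodule (ZMod p) (Fin n → ZMod p)) (J : Finset (Fin n)) :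
    Submodule (ZMod p) (Fin n → ZMod p) :=
  C ⊓ zeroAt p n J

open Polynomial in
/-- A polynomial of degree less than `k` can be prescribed both its
first `L` coefficients and its values at `#J` distinct nonzero nodes when `#J + L ≤ k`. -/
lemma exists_coeffs_of_initial_of_values {F ι : Type*} [Field F] [DecidableEq ι] {k L : ℕ}
    (hLk : L ≤ k) {α : ι → F} (hαinj : Function.Injective α) (hα0 : ∀ i, α i ≠ 0)
    (J : Finset ι) (hJ : J.card ≤ k - L) (s : Fin L → F) (u : ι → F) :
    ∃ c : Fin k → F, (∀ i, c (Fin.castLE hLk i) = s i) ∧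
      ∀ i ∈ J, ∑ j : Fin k, c j * α i ^ (j : ℕ) = u i := by
  obtain ⟨m, rfl⟩ := Nat.exists_eq_add_of_le hLk
  rw [Nat.add_sub_cancel_left] at hJ
  set q : F[X] := Lagrange.interpolate J α
    (fun i => (u i - ∑ j : Fin L, s j * α i ^ (j : ℕ)) / α i ^ L)
  have hdeg : q.degree < m :=
    (Lagrange.degree_interpolate_lt _ hαinj.injOn).trans_le (by exact_mod_cast hJ)
  refine ⟨Fin.append s (fun j : Fin m => q.coeff j), fun i => Fin.append_left _ _ i, ?_⟩
  intro i hi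
  have heval : ∑ j : Fin m, q.coeff j * α i ^ (j : ℕ) =
      (u i - ∑ j : Fin L, s j * α i ^ (j : ℕ)) / α i ^ L := by
    rw [Fin.sum_univ_eq_sum_range (fun j => q.coeff j * α i ^ j) m]
    refine Eq.trans ?_ (Lagrange.eval_interpolate_at_node (fun i =>
      (u i - ∑ j : Fin L, s j * α i ^ (j : ℕ)) / α i ^ L) hαinj.injOn hi)
    by_cases hq : q = 0
    · change _ = q.eval (α i)
      simp [hq]
    · exact (eval_eq_sum_range' ((natDegree_lt_iff_degree_lt hq).2 hdeg) _).symm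
  simp only [Fin.sum_univ_add, Fin.append_left, Fin.append_right, Fin.val_castAdd, Fin.val_natAdd,
    pow_add]
  have hfactor : ∑ j : Fin m, q.coeff j * (α i ^ L * α i ^ (j : ℕ)) =
      α i ^ L * ∑ j : Fin m, q.coeff j * α i ^ (j : ℕ) := by
    rw [Finset.mul_sum]
    exact Finset.sum_congr rfl fun j _ => by ring
  rw [hfactor, heval, mul_div_cancel₀ _ (pow_ne_zero _ (hα0 i))]
  ring

/-- A vector can be prescribed both on a set `J` of coordinates and in its first `k` power moments
with respect to distinct nodes when at least `k` coordinates lie outside `J`. -/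
lemma exists_vector_of_moments_of_values {F ι : Type*} [Field F] [Fintype ι] [DecidableEq ι]
    {k : ℕ} {α : ι → F} (hαinj : Function.Injective α) (J : Finset ι) (hJ : k ≤ Jᶜ.card)
    (b : Fin k → F) (u : ι → F) :
    ∃ x : ι → F, (∀ j : Fin k, ∑ i, x i * α i ^ (j : ℕ) = b j) ∧ ∀ i ∈ J, x i = u i := by
  obtain ⟨f⟩ : Nonempty (Fin k ↪ (Jᶜ : Finset ι)) :=
    Function.Embedding.nonempty_of_card_le (by rwa [Fintype.card_fin, Fintype.card_coe])
  have hfJ (t : Fin k) : (f t : ι) ∉ J := Finset.mem_compl.1 (f t).2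
  have hdet : IsUnit (Matrix.vandermonde fun t => α (f t)) := by
    rw [Matrix.isUnit_iff_isUnit_det, isUnit_iff_ne_zero, Matrix.det_vandermonde_ne_zero_iff]
    exact hαinj.comp (Subtype.val_injective.comp f.injective)
  obtain ⟨y, hy⟩ := Matrix.vecMul_surjective_iff_isUnit.2 hdet
    (fun j => b j - ∑ i ∈ J, u i * α i ^ (j : ℕ))
  refine ⟨fun i => (∑ t, if (f t : ι) = i then y t else 0) + if i ∈ J then u i else 0, ?_, ?_⟩
  · intro j
    have hj := congrFun hy j
    simp only [Matrix.vecMul, dotProduct, Matrix.vandermonde_apply] at hj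
    simp only [add_mul, Finset.sum_add_distrib, Finset.sum_mul, ite_mul, zero_mul]
    rw [Finset.sum_comm]
    simp [hj]
  · intro i hi
    have hne (t : Fin k) : (f t : ι) ≠ i := fun h => hfJ t (h ▸ hi)
    simp [hne, hi]

/-- Evaluation at at least `k` distinct points is injective on polynomials of degree less
than `k`. -/
lemma evLin_injective (p k n : ℕ) [Fact p.Prime] (hkn : k ≤ n) {α : Fin n → ZMod p}
    (hαinj : Function.Injective α) : Function.Injective (evLin p k n α) := by
  rw [← LinearMap.ker_eq_bot, LinearMap.ker_eq_bot']
  intro c hc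
  exact Matrix.eq_zero_of_forall_index_sum_mul_pow_eq_zero
    (hαinj.comp (Fin.castLE_injective hkn)) fun t => congrFun hc (Fin.castLE hkn t)

/-- The kernel of a surjective linear map has the expected dimension. -/
lemma LinearMap.finrank_ker_of_surjective {F V W : Type*} [Field F] [AddCommGroup V] [Module F V]
    [FiniteDimensional F V] [AddCommGroup W] [Module F W] {φ : V →ₗ[F] W}
    (hφ : Function.Surjective φ) :
    Module.finrank F (LinearMap.ker φ) = Module.finrank F V - Module.finrank F W := by
  rw [← φ.finrank_range_add_finrank_ker, LinearMap.range_eq_top.2 hφ, finrank_top,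
    Nat.add_sub_cancel_left]

lemma mem_dualCode_range_evLin_iff {p k n : ℕ} {α x : Fin n → ZMod p} :
    x ∈ dualCode p n (LinearMap.range (evLin p k n α)) ↔
      ∀ j : Fin k, ∑ i, x i * α i ^ (j : ℕ) = 0 := by
  constructor
  · intro h j
    simpa [evLin, ev, Pi.single_apply] using h _ ⟨Pi.single j 1, rfl⟩
  · rintro h _ ⟨c, rfl⟩
    simp only [evLin, ev, LinearMap.coe_mk, AddHom.coe_mk, Finset.mul_sum]
    rw [Finset.sum_comm]
    refine Finset.sum_eq_zero fun j _ => ?_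
    rw [← mul_zero (c j), ← h j, Finset.mul_sum]
    exact Finset.sum_congr rfl fun i _ => by ring

/-- The power moments of a vector together with its restriction to `J`. -/
def momentsAndRestrict (p k n : ℕ) (α : Fin n → ZMod p) (J : Finset (Fin n)) :
    (Fin n → ZMod p) →ₗ[ZMod p] (Fin k → ZMod p) × (J → ZMod p) :=
  (LinearMap.pi fun j : Fin k => ∑ i, α i ^ (j : ℕ) • LinearMap.proj i).prod
    (LinearMap.funLeft (ZMod p) (ZMod p) (Subtype.val : J → Fin n))

/-- The first `L` coefficients of a polynomial together with its values at the nodes in `J`. -/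
def initialCoeffsAndValues (p k L n : ℕ) (hLk : L ≤ k) (α : Fin n → ZMod p) (J : Finset (Fin n)) :
    (Fin k → ZMod p) →ₗ[ZMod p] (Fin L → ZMod p) × (J → ZMod p) :=
  (LinearMap.funLeft (ZMod p) (ZMod p) (Fin.castLE hLk)).prod
    (LinearMap.funLeft (ZMod p) (ZMod p) (Subtype.val : J → Fin n) ∘ₗ evLin p k n α)

lemma shortened_dualCode_eq_ker (p k n : ℕ) (α : Fin n → ZMod p) (J : Finset (Fin n)) :
    shortened p n (dualCode p n (LinearMap.range (evLin p k n α))) J =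
      LinearMap.ker (momentsAndRestrict p k n α J) := by
  ext x
  have hx : x ∈ zeroAt p n J ↔ ∀ i ∈ J, x i = 0 := Iff.rfl
  simp [shortened, mem_dualCode_range_evLin_iff, hx, momentsAndRestrict, LinearMap.funLeft,
    funext_iff, mul_comm]

lemma shortened_map_Dzero_eq_map_ker (p k L n : ℕ) (hLk : L ≤ k) (α : Fin n → ZMod p)
    (J : Finset (Fin n)) :
    shortened p n (Submodule.map (evLin p k n α) (Dzero p k L hLk)) J =
      Submodule.map (evLin p k n α) (LinearMap.ker (initialCoeffsAndValues p k L n hLk α J)) := by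
  have hker : LinearMap.ker (initialCoeffsAndValues p k L n hLk α J) =
      Dzero p k L hLk ⊓ (zeroAt p n J).comap (evLin p k n α) := by
    ext c
    have hc : c ∈ Dzero p k L hLk ↔ ∀ i : Fin L, c (Fin.castLE hLk i) = 0 := Iff.rfl
    have hz : evLin p k n α c ∈ zeroAt p n J ↔ ∀ i ∈ J, evLin p k n α c i = 0 := Iff.rfl
    simp [initialCoeffsAndValues, LinearMap.funLeft, funext_iff, hc, hz]
  rw [hker, shortened, Submodule.map_inf_eq_map_inf_comap]

/-- if `|J| ≤ k - L`, then shortening `C₁^⊥` or `C₂` at the positions of `J`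
decreases the dimension by exactly `|J|`:
`dim (C₁^⊥)_J = (k - L) - |J|` and `dim (C₂)_J = (k - L) - |J|`. -/
theorem shortened_dims (p k L n : ℕ) [Fact p.Prime]
    (hk : 0 < k) (hL : 0 < L) (hn0 : 0 < n) (hLk : L ≤ k)
    (hn : n = 2 * k - L) (hnp : n < p)
    (α : Fin n → ZMod p) (hαinj : Function.Injective α) (hα0 : ∀ i, α i ≠ 0)
    (J : Finset (Fin n)) (hJ : J.card ≤ k - L) :
    Module.finrank (ZMod p)
        (shortened p n (dualCode p n (LinearMap.range (evLin p k n α))) J) = (k - L) - J.card ∧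
    Module.finrank (ZMod p)
        (shortened p n (Submodule.map (evLin p k n α) (Dzero p k L hLk)) J) = (k - L) - J.card := by
  constructor
  · have hcard : k ≤ Jᶜ.card := by
      rw [Finset.card_compl, Fintype.card_fin]
      omega
    have hsurj : Function.Surjective (momentsAndRestrict p k n α J) := by
      rintro ⟨b, u⟩
      obtain ⟨x, hb, hu⟩ := exists_vector_of_moments_of_values hαinj J hcard b
        (fun i => if h : i ∈ J then u ⟨i, h⟩ else 0)
      refine ⟨x, Prod.ext (funext fun j => ?_) (funext fun i => ?_)⟩
      · simpa [momentsAndRestrict, mul_comm] using hb j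
      · simpa [momentsAndRestrict, LinearMap.funLeft] using hu i i.2
    rw [shortened_dualCode_eq_ker, LinearMap.finrank_ker_of_surjective hsurj]
    simp only [Module.finrank_prod, Module.finrank_fintype_fun_eq_card, Fintype.card_fin,
      Fintype.card_coe]
    omega
  · have hsurj : Function.Surjective (initialCoeffsAndValues p k L n hLk α J) := by
      rintro ⟨s, u⟩
      obtain ⟨c, hs, hu⟩ := exists_coeffs_of_initial_of_values hLk hαinj hα0 J hJ s
        (fun i => if h : i ∈ J then u ⟨i, h⟩ else 0)
      refine ⟨c, Prod.ext (funext fun j => ?_) (funext fun i => ?_)⟩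
      · simpa [initialCoeffsAndValues, LinearMap.funLeft] using hs j
      · simpa [initialCoeffsAndValues, LinearMap.funLeft, evLin, ev] using hu i i.2
    rw [shortened_map_Dzero_eq_map_ker, ← (Submodule.equivMapOfInjective _
      (evLin_injective p k n (by omega) hαinj) _).finrank_eq, LinearMap.finrank_ker_of_surjective hsurj]
    simp only [Module.finrank_prod, Module.finrank_fintype_fun_eq_card, Fintype.card_fin,
      Fintype.card_coe]
    omega
end
end

section
/- Let C = C₁^⊥ × C₂ ⊆ F_p^n × F_p^n, and for a set J of coordinate positions let C_J = {(a, b) ∈ C : aᵢ = bᵢ = 0 for all i ∈ J}. Then dim C_J + 2|J| = dim C (equivalently, dim C_J = dim C − 2|J| as integers) holds if and only if |J| ≤ k − L. Consequently, in Ogawa et al.'s (k, L, n) ramp quantum secret sharing scheme, a set J of shares is advance shareable (by the criterion of Shibata–Matsumoto) if and only if |J| ≤ k − L. -/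
open scoped BigOperators

noncomputable section

/-- The pairs `(a, b) ∈ F_p^n × F_p^n` with `aᵢ = bᵢ = 0` for all `i ∈ J`. -/
def pairZeroAt (p n : ℕ) (J : Finset (Fin n)) :
    Submodule (ZMod p) ((Fin n → ZMod p) × (Fin n → ZMod p)) where
  carrier := {w | ∀ i ∈ J, w.1 i = 0 ∧ w.2 i = 0}
  add_mem' := fun ha hb i hi => by
    simp [Pi.add_apply, (ha i hi).1, (ha i hi).2, (hb i hi).1, (hb i hi).2]
  zero_mem' := fun i _ => ⟨rfl, rfl⟩
  smul_mem' := fun r w hw i hi => by simp [Pi.smul_apply, (hw i hi).1, (hw i hi).2]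

/-- The shortening `C_J = {(a, b) ∈ C : aᵢ = bᵢ = 0 for all i ∈ J}` of a code
`C ⊆ F_p^n × F_p^n`. -/
def pairShortened (p n : ℕ) (C : Submodule (ZMod p) ((Fin n → ZMod p) × (Fin n → ZMod p)))
    (J : Finset (Fin n)) : Submodule (ZMod p) ((Fin n → ZMod p) × (Fin n → ZMod p)) :=
  C ⊓ pairZeroAt p n J

theorem finrank_inf_ker_add_eq_iff {K V W : Type*} [Field K] [AddCommGroup V] [Module K V]
    [FiniteDimensional K V] [AddCommGroup W] [Module K W] [FiniteDimensional K W]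
    (C : Submodule K V) (φ : V →ₗ[K] W) :
    Module.finrank K (C ⊓ LinearMap.ker φ : Submodule K V) + Module.finrank K W =
      Module.finrank K C ↔ ∀ w, ∃ v ∈ C, φ v = w := by
  have h1 := LinearMap.finrank_range_add_finrank_ker (φ ∘ₗ C.subtype)
  have h2 : Module.finrank K (LinearMap.ker (φ ∘ₗ C.subtype)) =
      Module.finrank K (C ⊓ LinearMap.ker φ : Submodule K V) := by
    rw [LinearMap.ker_comp, ← Submodule.map_comap_subtype, Submodule.finrank_map_subtype_eq]
  have h3 : (∀ w, ∃ v ∈ C, φ v = w) ↔ LinearMap.range (φ ∘ₗ C.subtype) = ⊤ := by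
    rw [LinearMap.range_eq_top]
    exact ⟨fun h w => let ⟨v, hv, e⟩ := h w; ⟨⟨v, hv⟩, e⟩,
      fun h w => let ⟨v, e⟩ := h w; ⟨v, v.2, e⟩⟩
  rw [h3]
  constructor
  · intro h
    apply Submodule.eq_top_of_finrank_eq
    omega
  · intro h
    rw [h, finrank_top] at h1
    omega

/-- Restriction of a pair of words to the positions in `J`. -/
def pairRestrict (p n : ℕ) (J : Finset (Fin n)) :
    ((Fin n → ZMod p) × (Fin n → ZMod p)) →ₗ[ZMod p] (J → ZMod p) × (J → ZMod p) :=
  (LinearMap.funLeft (ZMod p) (ZMod p) (Subtype.val : J → Fin n)).prodMap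
    (LinearMap.funLeft (ZMod p) (ZMod p) (Subtype.val : J → Fin n))

theorem ker_pairRestrict (p n : ℕ) (J : Finset (Fin n)) :
    LinearMap.ker (pairRestrict p n J) = pairZeroAt p n J := by
  ext ⟨a, b⟩
  simp only [LinearMap.mem_ker, pairRestrict, LinearMap.prodMap_apply, Prod.mk_eq_zero]
  change _ ↔ ∀ i ∈ J, a i = 0 ∧ b i = 0
  simp [funext_iff, LinearMap.funLeft_apply, forall_and]

theorem ev_eq_eval (p k n : ℕ) (α : Fin n → ZMod p) (c : Fin k → ZMod p) (i : Fin n) :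
    ev p k n α c i =
      (∑ j : Fin k, Polynomial.C (c j) * Polynomial.X ^ (j : ℕ)).eval (α i) := by
  simp [ev, Polynomial.eval_finsetSum]

theorem ev_coeff (p k n : ℕ) (α : Fin n → ZMod p) (f : Polynomial (ZMod p))
    (hf : f.degree < k) (i : Fin n) :
    ev p k n α (fun j => f.coeff j) i = f.eval (α i) := by
  rw [ev, Fin.sum_univ_eq_sum_range (fun j => f.coeff j * α i ^ j) k]
  by_cases h0 : f = 0
  · simp [h0]
  · exact (Polynomial.eval_eq_sum_range' ((Polynomial.natDegree_lt_iff_degree_lt h0).2 hf) _).symm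

theorem exists_mem_dualCode (p k n : ℕ) [Fact p.Prime] (α : Fin n → ZMod p)
    (hα : Function.Injective α) (J : Finset (Fin n)) (hJ : k + J.card ≤ n) (u : J → ZMod p) :
    ∃ a ∈ dualCode p n (LinearMap.range (evLin p k n α)), ∀ i : J, a i = u i := by
  classical
  set u' : Fin n → ZMod p := fun i => if h : i ∈ J then u ⟨i, h⟩ else 0 with hu'
  refine ⟨fun i => if i ∈ J then u' i else
    -∑ i' ∈ J, u' i' * (Lagrange.basis Jᶜ α i).eval (α i'), ?_, fun i => by simp [hu']⟩
  rintro _ ⟨c, rfl⟩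
  change ∑ i, _ * ev p k n α c i = 0
  simp only [ev_eq_eval]
  set f : Polynomial (ZMod p) :=
    ∑ j : Fin k, Polynomial.C (c j) * Polynomial.X ^ (j : ℕ) with hf
  have hdeg : f.degree < (Jᶜ).card := by
    refine (Polynomial.degree_sum_fin_lt c).trans_le ?_
    rw [Finset.card_compl, Fintype.card_fin]
    exact_mod_cast (by omega : k ≤ n - J.card)
  have hi := Lagrange.eq_interpolate (s := Jᶜ) hα.injOn hdeg
  have he : ∀ x, f.eval x = ∑ i ∈ Jᶜ, f.eval (α i) * (Lagrange.basis Jᶜ α i).eval x := by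
    intro x
    conv_lhs => rw [hi]
    simp [Lagrange.interpolate_apply, Polynomial.eval_finsetSum]
  rw [← Finset.sum_add_sum_compl J]
  have h1 : ∑ i ∈ J, (if i ∈ J then u' i else
      -∑ i' ∈ J, u' i' * (Lagrange.basis Jᶜ α i).eval (α i')) * f.eval (α i) =
      ∑ i' ∈ J, ∑ i ∈ Jᶜ, u' i' * (Lagrange.basis Jᶜ α i).eval (α i') * f.eval (α i) := by
    refine Finset.sum_congr rfl fun i hi => ?_
    rw [if_pos hi, he (α i), Finset.mul_sum]
    exact Finset.sum_congr rfl fun _ _ => by ring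
  have h2 : ∑ i ∈ Jᶜ, (if i ∈ J then u' i else
      -∑ i' ∈ J, u' i' * (Lagrange.basis Jᶜ α i).eval (α i')) * f.eval (α i) =
      -∑ i ∈ Jᶜ, ∑ i' ∈ J, u' i' * (Lagrange.basis Jᶜ α i).eval (α i') * f.eval (α i) := by
    rw [← Finset.sum_neg_distrib]
    refine Finset.sum_congr rfl fun i hi => ?_
    rw [if_neg (Finset.mem_compl.1 hi), neg_mul, Finset.sum_mul]
  rw [h1, h2, Finset.sum_comm, add_neg_cancel]

theorem exists_mem_map_Dzero (p k L n : ℕ) [Fact p.Prime] (hLk : L ≤ k) (α : Fin n → ZMod p)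
    (hα : Function.Injective α) (hα0 : ∀ i, α i ≠ 0) (J : Finset (Fin n))
    (hJ : J.card ≤ k - L) (u : J → ZMod p) :
    ∃ b ∈ Submodule.map (evLin p k n α) (Dzero p k L hLk), ∀ i : J, b i = u i := by
  classical
  set g := Lagrange.interpolate J α
    (fun i => if h : i ∈ J then u ⟨i, h⟩ * (α i ^ L)⁻¹ else 0) with hg
  have hgdeg : g.degree < J.card := Lagrange.degree_interpolate_lt _ hα.injOn
  have hdeg : (g * Polynomial.X ^ L).degree < (k : WithBot ℕ) := by
    rw [Polynomial.degree_mul, Polynomial.degree_X_pow]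
    by_cases h0 : g = 0
    · simp [h0]
    · rw [Polynomial.degree_eq_natDegree h0] at hgdeg ⊢
      norm_cast at hgdeg ⊢
      omega
  refine ⟨_, ⟨fun j => (g * Polynomial.X ^ L).coeff j, ?_, rfl⟩, fun i => ?_⟩
  · intro i
    have := i.2
    simp [Polynomial.coeff_mul_X_pow']
  · change ev p k n α _ i = _
    rw [ev_coeff p k n α _ hdeg, Polynomial.eval_mul, hg,
      Lagrange.eval_interpolate_at_node _ hα.injOn i.2]
    simp [hα0]

theorem card_le_of_forall_exists_mem_map_Dzero (p k L n : ℕ) [Fact p.Prime] (hLk : L ≤ k)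
    (α : Fin n → ZMod p) (J : Finset (Fin n))
    (h : ∀ u : J → ZMod p,
      ∃ b ∈ Submodule.map (evLin p k n α) (Dzero p k L hLk), ∀ i : J, b i = u i) :
    J.card ≤ k - L := by
  obtain ⟨m, rfl⟩ := Nat.exists_eq_add_of_le hLk
  let ψ : (Fin m → ZMod p) →ₗ[ZMod p] (J → ZMod p) :=
    Matrix.mulVecLin (Matrix.of fun (i : J) (j : Fin m) => α i ^ (L + (j : ℕ)))
  have hψ : Function.Surjective ψ := by
    intro u
    obtain ⟨_, ⟨c, hc, rfl⟩, hb⟩ := h u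
    refine ⟨fun j => c (Fin.natAdd L j), funext fun i => ?_⟩
    rw [← hb i]
    change _ = ∑ j : Fin (L + m), c j * α i ^ (j : ℕ)
    rw [Fin.sum_univ_add]
    have hz : ∀ j : Fin L, c (Fin.castAdd m j) = 0 := hc
    simp [ψ, Matrix.mulVec, dotProduct, hz, mul_comm]
  have := LinearMap.finrank_le_finrank_of_surjective hψ
  simpa using this

/-- for `C = C₁^⊥ × C₂`, the Shibata–Matsumoto criterion
`dim C_J + 2|J| = dim C` (i.e. `dim C_J = dim C − 2|J|`) holds if and only if
`|J| ≤ k − L`; that is, a set `J` of shares is advance shareable in Ogawa et al.'s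
`(k, L, n)` ramp quantum secret sharing scheme if and only if `|J| ≤ k − L`. -/
theorem advance_shareable_iff (p k L n : ℕ) [Fact p.Prime]
    (hk : 0 < k) (hL : 0 < L) (hn0 : 0 < n) (hLk : L ≤ k)
    (hn : n = 2 * k - L) (hnp : n < p)
    (α : Fin n → ZMod p) (hαinj : Function.Injective α) (hα0 : ∀ i, α i ≠ 0)
    (J : Finset (Fin n)) :
    (Module.finrank (ZMod p)
        (pairShortened p n
          ((dualCode p n (LinearMap.range (evLin p k n α))).prod
            (Submodule.map (evLin p k n α) (Dzero p k L hLk))) J)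
      + 2 * J.card
      = Module.finrank (ZMod p)
          ((dualCode p n (LinearMap.range (evLin p k n α))).prod
            (Submodule.map (evLin p k n α) (Dzero p k L hLk))))
    ↔ J.card ≤ k - L := by
  have hW : Module.finrank (ZMod p) ((J → ZMod p) × (J → ZMod p)) = 2 * J.card := by
    simp [two_mul]
  rw [pairShortened, ← ker_pairRestrict, ← hW, finrank_inf_ker_add_eq_iff]
  constructor
  · intro h
    refine card_le_of_forall_exists_mem_map_Dzero p k L n hLk α J fun u => ?_
    obtain ⟨⟨a, b⟩, hab, e⟩ := h (0, u)
    exact ⟨b, hab.2, fun i => congrFun (congrArg Prod.snd e) i⟩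
  · rintro h ⟨u, v⟩
    obtain ⟨a, ha, hau⟩ := exists_mem_dualCode p k n α hαinj J (by omega) u
    obtain ⟨b, hb, hbv⟩ := exists_mem_map_Dzero p k L n hLk α hαinj hα0 J h v
    exact ⟨(a, b), ⟨ha, hb⟩, Prod.ext (funext hau) (funext hbv)⟩
end
end
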